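/- In the reduction setup, with δ = M² e^{−nε²/2}, the learner's realized utility satisfies E[V(Id)] ≤ E[V̄(Id)] + ε + 2δ, where V(Id) = (1/T) Σ_{t=1}^T Σ_{x∈X} π^t(x) ⟨x, ũ^t⟩, V̄(Id) = (1/T) Σ_{t=1}^T Σ_{x∈X} π^t(x) p_x(u^t), and Id denotes the identity deviation. -/

import Mathlib

/-! ## The reduction setup -/

/-- A pure strategy of the tree-form decision problem: a choice of `i ∈ [d]`
together with, for each `j ∈ [n]`, a binary action (a sign).  Its
realization-form vector (`stratVec`) lies in `X_i ⊆ ℝ^{d×n}`. -/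
abbrev Strat (d n : ℕ) := Fin d × (Fin n → Bool)

/-- The inner product of the two vectors in `{-1/√n, 1/√n}^n` encoded by the
sign patterns `s, s' : Fin n → Bool` (`true ↦ 1/√n`, `false ↦ -1/√n`). -/
noncomputable def ip (n : ℕ) (s s' : Fin n → Bool) : ℝ :=
  ∑ j, ((if s j then 1 else -1) / Real.sqrt n) * ((if s' j then 1 else -1) / Real.sqrt n)

/-- The realization-form vector in `ℝ^{d×n}` of the pure strategy `x`: the
`x.1`-th row lies in `{-1/√n, 1/√n}^n` (signs given by `x.2`), other rows 0. -/
noncomputable def stratVec (d n : ℕ) (x : Strat d n) : Fin d → Fin n → ℝ :=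
  fun i j => if i = x.1 then (if x.2 j then 1 else -1) / Real.sqrt n else 0

/-- The standard inner product on `ℝ^{d×n}`. -/
noncomputable def dot (d n : ℕ) (v w : Fin d → Fin n → ℝ) : ℝ :=
  ∑ i, ∑ j, v i j * w i j

/-- The action set `A = A_1 ⊔ ⋯ ⊔ A_d ⊔ {a*}`, with `A_i = {a_{i1}, …, a_{iM_i}}`:
`some ⟨i, j⟩` is the action `a_{ij}` and `none` is the distinguished action `a*`. -/
abbrev Act (d : ℕ) (Mi : Fin d → ℕ) := Option ((i : Fin d) × Fin (Mi i))

/-- The sample space for the random vectors `ã_{ij}` (sign patterns, uniform). -/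
abbrev Atil (d n : ℕ) (Mi : Fin d → ℕ) := (i : Fin d) → Fin (Mi i) → Fin n → Bool

/-- The random map `ψ : A → X`, sending `a_{ij}` to `ã_{ij} ∈ X_i` and `a*` to
the fixed element `x₀`. -/
def psi {d n : ℕ} {Mi : Fin d → ℕ} (x₀ : Strat d n) (atil : Atil d n Mi) :
    Act d Mi → Strat d n
  | none => x₀
  | some p => (p.1, atil p.1 p.2)

/-- `firstTime T U a` is the first (1-indexed) iteration `t ∈ [T]` at which the
sequence `U` plays the action `a`, or `T` if this never happens. -/
noncomputable def firstTime {d : ℕ} {Mi : Fin d → ℕ} (T : ℕ) (U : Fin T → Act d Mi)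
    (a : Act d Mi) : ℕ :=
  sInf ({T} ∪ {k | ∃ t : Fin T, U t = a ∧ k = t.val + 1})

open scoped Classical in
/-- The set of indices `j` with `⟨x, ã_{x.1 j}⟩ > ε`. -/
noncomputable def goodJ {d n : ℕ} {Mi : Fin d → ℕ} (atil : Atil d n Mi) (ε : ℝ)
    (x : Strat d n) : Finset (Fin (Mi x.1)) :=
  Finset.univ.filter fun j => ε < ip n x.2 (atil x.1 j)

/-- `t_x`: if `⟨x, ã_{x.1 j}⟩ ≤ ε` for all `j`, then `t_x = 0`; otherwise
`t_x = t_{x.1 j}` for the largest `j` with `⟨x, ã_{x.1 j}⟩ > ε`. -/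
noncomputable def txOf {d n : ℕ} {Mi : Fin d → ℕ} (T : ℕ) (U : Fin T → Act d Mi)
    (atil : Atil d n Mi) (ε : ℝ) (x : Strat d n) : ℕ :=
  if h : (goodJ atil ε x).Nonempty then
    firstTime T U (some ⟨x.1, (goodJ atil ε x).max' h⟩)
  else 0

open scoped Classical in
/-- The distribution `p_x ∈ Δ(A)`: if `⟨x, ã_{x.1 j}⟩ ≤ ε` for all `j`, the
point mass on `a*`; otherwise, with `j` the largest index with
`⟨x, ã_{x.1 j}⟩ > ε` and `β = ⟨x, ã_{x.1 j}⟩`, mass `β` on `a_{x.1 j}` and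
mass `1 - β` on `a*`. -/
noncomputable def pxval {d n : ℕ} {Mi : Fin d → ℕ} (atil : Atil d n Mi) (ε : ℝ)
    (x : Strat d n) (a : Act d Mi) : ℝ :=
  if h : (goodJ atil ε x).Nonempty then
    if a = some ⟨x.1, (goodJ atil ε x).max' h⟩ then
      ip n x.2 (atil x.1 ((goodJ atil ε x).max' h))
    else if a = none then 1 - ip n x.2 (atil x.1 ((goodJ atil ε x).max' h))
    else 0
  else if a = none then 1 else 0

/-- The mixed strategy `π^t ∈ Δ(X)` played by the learner (with internal
random seed `ω`) at time `t`, as a function of the previously observed utility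
vectors `ũ^1, …, ũ^{t-1}` (where `ũ^s = ψ(u^s)`). -/
def play {d n T : ℕ} {Mi : Fin d → ℕ} {Ω : Type}
    (π : Ω → (t : Fin T) → (Fin t.val → Strat d n) → Strat d n → ℝ)
    (x₀ : Strat d n) (atil : Atil d n Mi) (ω : Ω) (U : Fin T → Act d Mi)
    (t : Fin T) : Strat d n → ℝ :=
  π ω t fun s => psi x₀ atil (U ⟨s.val, s.isLt.trans t.isLt⟩)

lemma sum_exp_mul_ip (n : ℕ) (l : ℝ) (x : Fin n → Bool) :
    ∑ s : Fin n → Bool, Real.exp (l * ip n x s) = (2 * Real.cosh (l / n)) ^ n := by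
  have hfac : ∀ s : Fin n → Bool, Real.exp (l * ip n x s) =
      ∏ k, Real.exp (l * (((if x k then 1 else -1) / Real.sqrt n) *
        ((if s k then 1 else -1) / Real.sqrt n))) := by
    intro s
    rw [ip, Finset.mul_sum, Real.exp_sum]
  simp_rw [hfac]
  rw [← Fintype.prod_sum (fun (k : Fin n) (b : Bool) =>
    Real.exp (l * (((if x k then 1 else -1) / Real.sqrt n) *
      ((if b then 1 else -1) / Real.sqrt n))))]
  have hk : ∀ k : Fin n, ∑ b : Bool, Real.exp (l * (((if x k then 1 else -1) / Real.sqrt n) *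
      ((if b then 1 else -1) / Real.sqrt n))) = 2 * Real.cosh (l / n) := by
    intro k
    have hs : Real.sqrt n * Real.sqrt n = n := Real.mul_self_sqrt (Nat.cast_nonneg n)
    simp_rw [Real.cosh_eq, Fintype.sum_bool, div_mul_div_comm, hs]
    cases x k <;> simp [div_eq_mul_inv] <;> ring
  rw [Finset.prod_congr rfl fun k _ => hk k]
  simp

open scoped Classical in
/-- Chernoff bound for the number of sign patterns having inner product larger than `ε`
with a given one. -/
lemma sum_indicator_ip_le {n : ℕ} (hn : 0 < n) {ε : ℝ} (hε : 0 < ε) (x : Fin n → Bool) :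
    ∑ s : Fin n → Bool, (if ε < ip n x s then (1 : ℝ) else 0) ≤
      2 ^ n * Real.exp (-(n : ℝ) * ε ^ 2 / 2) := by
  have hn' : (0 : ℝ) < n := Nat.cast_pos.mpr hn
  calc ∑ s : Fin n → Bool, (if ε < ip n x s then (1 : ℝ) else 0)
      ≤ ∑ s : Fin n → Bool, Real.exp (-(n * ε * ε)) * Real.exp (n * ε * ip n x s) := by
        refine Finset.sum_le_sum fun s _ => ?_
        rw [← Real.exp_add]
        split_ifs with h
        · refine Real.one_le_exp ?_
          have := mul_le_mul_of_nonneg_left h.le (mul_pos hn' hε).le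
          linarith
        · positivity
    _ = Real.exp (-(n * ε * ε)) * (2 * Real.cosh ε) ^ n := by
        rw [← Finset.mul_sum, sum_exp_mul_ip]
        congr 4
        field_simp
    _ ≤ Real.exp (-(n * ε * ε)) * (2 * Real.exp (ε ^ 2 / 2)) ^ n := by
        gcongr
        exact Real.cosh_le_exp_half_sq ε
    _ = 2 ^ n * Real.exp (-(n : ℝ) * ε ^ 2 / 2) := by
        rw [mul_pow, ← Real.exp_nat_mul, mul_left_comm, ← Real.exp_add]
        congr 2
        ring

lemma ip_le_one (n : ℕ) (x s : Fin n → Bool) : ip n x s ≤ 1 := by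
  have hs : Real.sqrt n * Real.sqrt n = n := Real.mul_self_sqrt (Nat.cast_nonneg n)
  calc ip n x s ≤ ∑ _k : Fin n, (n : ℝ)⁻¹ := by
        refine Finset.sum_le_sum fun k _ => ?_
        rw [div_mul_div_comm, hs, div_eq_mul_inv]
        have : (0 : ℝ) ≤ (n : ℝ)⁻¹ := by positivity
        split_ifs <;> linarith
    _ ≤ 1 := by
        simp only [Finset.sum_const, Finset.card_univ, Fintype.card_fin, nsmul_eq_mul]
        exact mul_inv_le_one

lemma dot_stratVec (d n : ℕ) (x y : Strat d n) :
    dot d n (stratVec d n x) (stratVec d n y) = if x.1 = y.1 then ip n x.2 y.2 else 0 := by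
  rw [dot, Finset.sum_eq_single x.1]
  · split_ifs with h <;> simp [stratVec, ip, h]
  · intro i _ hi
    simp [stratVec, hi]
  · simp

/-- Flip the signs of the row `ã_{ij}` at the positions selected by `s`. -/
def flipRow {d n : ℕ} {Mi : Fin d → ℕ} (i : Fin d) (j : Fin (Mi i)) (s : Fin n → Bool)
    (atil : Atil d n Mi) : Atil d n Mi :=
  Function.update atil i (Function.update (atil i) j fun k => xor (atil i j k) (s k))

lemma flipRow_self {d n : ℕ} {Mi : Fin d → ℕ} (i : Fin d) (j : Fin (Mi i)) (s : Fin n → Bool)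
    (atil : Atil d n Mi) : flipRow i j s atil i j = fun k => xor (atil i j k) (s k) := by
  simp [flipRow]

lemma flipRow_involutive {d n : ℕ} {Mi : Fin d → ℕ} (i : Fin d) (j : Fin (Mi i))
    (s : Fin n → Bool) : Function.Involutive (flipRow (n := n) (Mi := Mi) i j s) := by
  intro atil
  simp [flipRow]

lemma psi_flipRow {d n : ℕ} {Mi : Fin d → ℕ} (x₀ : Strat d n) (i : Fin d) (j : Fin (Mi i))
    (s : Fin n → Bool) (atil : Atil d n Mi) (a : Act d Mi) (ha : a ≠ some ⟨i, j⟩) :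
    psi x₀ (flipRow i j s atil) a = psi x₀ atil a := by
  rcases a with _ | ⟨i', j'⟩
  · rfl
  · simp only [psi]
    congr 1
    by_cases hi : i' = i
    · subst hi
      have hj : j' ≠ j := fun h => ha (by rw [h])
      simp [flipRow, hj]
    · simp [flipRow, hi]

/-- Averaging over a uniform row that `G` does not otherwise depend on. -/
lemma sum_row_resample {d n : ℕ} {Mi : Fin d → ℕ} (i : Fin d) (j : Fin (Mi i))
    (G : Atil d n Mi → (Fin n → Bool) → ℝ)
    (hG : ∀ s atil, G (flipRow i j s atil) = G atil) :
    2 ^ n * ∑ atil, G atil (atil i j) = ∑ atil, ∑ s, G atil s := by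
  have h1 : ∀ s : Fin n → Bool, ∑ atil, G atil (atil i j) =
      ∑ atil : Atil d n Mi, G atil fun k => xor (atil i j k) (s k) := by
    intro s
    rw [← Equiv.sum_comp (flipRow_involutive i j s).toPerm]
    simp [Function.Involutive.coe_toPerm, hG, flipRow_self]
  have h2 : ∀ atil : Atil d n Mi,
      ∑ s : Fin n → Bool, G atil (fun k => xor (atil i j k) (s k)) = ∑ s, G atil s := by
    intro atil
    have hinv : Function.Involutive fun (s : Fin n → Bool) k => xor (atil i j k) (s k) := by
      intro s
      simp
    exact Equiv.sum_comp hinv.toPerm (G atil)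
  have h3 : ∑ _s : Fin n → Bool, ∑ atil, G atil (atil i j) =
      2 ^ n * ∑ atil, G atil (atil i j) := by
    simp
  rw [← h3, Finset.sum_congr rfl fun s _ => h1 s, Finset.sum_comm]
  exact Finset.sum_congr rfl fun atil _ => h2 atil

open scoped Classical in
lemma pxval_some_nonneg {d n : ℕ} {Mi : Fin d → ℕ} (atil : Atil d n Mi) {ε : ℝ} (hε : 0 < ε)
    (x : Strat d n) (p : (i : Fin d) × Fin (Mi i)) : 0 ≤ pxval atil ε x (some p) := by
  unfold pxval
  split_ifs with h h1 h2 h3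
  · have := Finset.max'_mem _ h
    simp only [goodJ, Finset.mem_filter] at this
    exact (hε.trans this.2).le
  all_goals simp_all

open scoped Classical in
lemma dot_le_pxval_add {d n : ℕ} {Mi : Fin d → ℕ} (x₀ : Strat d n) (atil : Atil d n Mi) {ε : ℝ}
    (hε : 0 < ε) (x : Strat d n) (i : Fin d) (j : Fin (Mi i)) :
    dot d n (stratVec d n x) (stratVec d n (psi x₀ atil (some ⟨i, j⟩))) ≤
      pxval atil ε x (some ⟨i, j⟩) + ε +
        ∑ j' ∈ Finset.univ.filter (j < ·), if ε < ip n x.2 (atil i j') then (1 : ℝ) else 0 := by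
  have hp := pxval_some_nonneg atil hε x ⟨i, j⟩
  have hnn : ∀ j', (0 : ℝ) ≤ if ε < ip n x.2 (atil i j') then (1 : ℝ) else 0 := by
    intro j'
    split_ifs <;> norm_num
  have hs : (0 : ℝ) ≤ ∑ j' ∈ Finset.univ.filter (j < ·),
      if ε < ip n x.2 (atil i j') then (1 : ℝ) else 0 :=
    Finset.sum_nonneg fun j' _ => hnn j'
  rw [show psi x₀ atil (some ⟨i, j⟩) = (i, atil i j) from rfl, dot_stratVec]
  by_cases hi : x.1 = i
  · rw [if_pos hi]
    obtain ⟨i', x⟩ := x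
    dsimp only at hi
    subst hi
    by_cases hj : ε < ip n x (atil i' j)
    · have hjm : j ∈ goodJ atil ε (i', x) := by simpa [goodJ] using hj
      have hne : (goodJ atil ε (i', x)).Nonempty := ⟨j, hjm⟩
      rcases (Finset.le_max' _ j hjm).eq_or_lt with h | h
      · have : pxval atil ε (i', x) (some ⟨i', j⟩) = ip n x (atil i' j) := by
          unfold pxval
          rw [dif_pos hne, if_pos (by rw [← h]), ← h]
        dsimp only
        linarith
      · have hm := Finset.max'_mem _ hne
        have hm' : ε < ip n x (atil i' ((goodJ atil ε (i', x)).max' hne)) := by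
          simpa [goodJ] using hm
        have h1 := Finset.single_le_sum (f := fun j' =>
          if ε < ip n x (atil i' j') then (1 : ℝ) else 0) (fun j' _ => hnn j')
          (Finset.mem_filter.mpr ⟨Finset.mem_univ _, h⟩)
        rw [if_pos hm'] at h1
        have := ip_le_one n x (atil i' j)
        dsimp only at *
        linarith
    · dsimp only at *
      linarith
  · rw [if_neg hi]
    linarith

open scoped Classical in
/-- The rows not yet revealed at time `t` are unlikely to correlate with the learner's play. -/
lemma sum_play_indicator_le {d n T : ℕ} {Mi : Fin d → ℕ} (hn : 0 < n) {ε : ℝ} (hε : 0 < ε)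
    {Ω : Type} (π : Ω → (t : Fin T) → (Fin t.val → Strat d n) → Strat d n → ℝ)
    (hπ0 : ∀ ω t h x, 0 ≤ π ω t h x) (hπ1 : ∀ ω t h, ∑ x, π ω t h x = 1)
    (x₀ : Strat d n) (ω : Ω) (U : Fin T → Act d Mi) (t : Fin T) (i : Fin d) (j : Fin (Mi i))
    (hU : ∀ t' < t, U t' ≠ some ⟨i, j⟩) :
    ∑ atil : Atil d n Mi, ∑ x, play π x₀ atil ω U t x *
        (if ε < ip n x.2 (atil i j) then (1 : ℝ) else 0) ≤
      Fintype.card (Atil d n Mi) * Real.exp (-(n : ℝ) * ε ^ 2 / 2) := by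
  have hplay : ∀ s (atil : Atil d n Mi),
      play π x₀ (flipRow i j s atil) ω U t = play π x₀ atil ω U t := by
    intro s atil
    unfold play
    congr 1
    funext r
    exact psi_flipRow x₀ i j s atil _ (hU _ r.isLt)
  have key := sum_row_resample i j (fun (atil : Atil d n Mi) s => ∑ x, play π x₀ atil ω U t x *
    (if ε < ip n x.2 s then (1 : ℝ) else 0)) (fun s atil => by simp only [hplay])
  have hb : ∀ atil : Atil d n Mi, ∑ s, ∑ x, play π x₀ atil ω U t x *
      (if ε < ip n x.2 s then (1 : ℝ) else 0) ≤ 2 ^ n * Real.exp (-(n : ℝ) * ε ^ 2 / 2) := by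
    intro atil
    rw [Finset.sum_comm]
    simp_rw [← Finset.mul_sum]
    calc ∑ x, play π x₀ atil ω U t x * ∑ s, (if ε < ip n x.2 s then (1 : ℝ) else 0)
        ≤ ∑ x, play π x₀ atil ω U t x * (2 ^ n * Real.exp (-(n : ℝ) * ε ^ 2 / 2)) :=
          Finset.sum_le_sum fun x _ =>
            mul_le_mul_of_nonneg_left (sum_indicator_ip_le hn hε x.2) (hπ0 _ _ _ _)
      _ = 2 ^ n * Real.exp (-(n : ℝ) * ε ^ 2 / 2) := by
          rw [← Finset.sum_mul]
          unfold play
          rw [hπ1, one_mul]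
  have hsum := Finset.sum_le_sum fun (atil : Atil d n Mi) (_ : atil ∈ Finset.univ) => hb atil
  rw [← key, Finset.sum_const, Finset.card_univ, nsmul_eq_mul, mul_left_comm] at hsum
  exact le_of_mul_le_mul_left hsum (by positivity)

lemma average_utility_le {d n T M : ℕ} (hn : 0 < n) {Mi : Fin d → ℕ} (hM : ∑ i, Mi i = M)
    {ε : ℝ} (hε : 0 < ε) (x₀ : Strat d n) (U : Fin T → Act d Mi)
    (hsupp : ∀ t, U t ≠ none)
    (hinc : ∀ (t t' : Fin T) (i : Fin d) (j j' : Fin (Mi i)),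
      t ≤ t' → U t = some ⟨i, j⟩ → U t' = some ⟨i, j'⟩ → j ≤ j')
    {Ω : Type} (π : Ω → (t : Fin T) → (Fin t.val → Strat d n) → Strat d n → ℝ)
    (hπ0 : ∀ ω t h x, 0 ≤ π ω t h x) (hπ1 : ∀ ω t h, ∑ x, π ω t h x = 1) (ω : Ω) (t : Fin T) :
    ∑ atil : Atil d n Mi, ((Fintype.card (Atil d n Mi) : ℝ))⁻¹ * ∑ x : Strat d n,
        play π x₀ atil ω U t x * dot d n (stratVec d n x) (stratVec d n (psi x₀ atil (U t))) ≤
      ∑ atil : Atil d n Mi, ((Fintype.card (Atil d n Mi) : ℝ))⁻¹ * ∑ x : Strat d n,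
        play π x₀ atil ω U t x * pxval atil ε x (U t) +
      (ε + 2 * ((M : ℝ) ^ 2 * Real.exp (-(n : ℝ) * ε ^ 2 / 2))) := by
  classical
  obtain ⟨⟨i, j⟩, ha⟩ := Option.ne_none_iff_exists'.mp (hsupp t)
  set N : ℝ := (Fintype.card (Atil d n Mi) : ℝ) with hN
  have hNpos : 0 < N := Nat.cast_pos.mpr Fintype.card_pos
  set δ := Real.exp (-(n : ℝ) * ε ^ 2 / 2) with hδ
  have hδ0 : 0 ≤ δ := (Real.exp_pos _).le
  set J := Finset.univ.filter (j < ·) with hJ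
  have hlate : ∑ atil : Atil d n Mi, ∑ x, play π x₀ atil ω U t x *
      ∑ j' ∈ J, (if ε < ip n x.2 (atil i j') then (1 : ℝ) else 0) ≤ J.card * (N * δ) := by
    simp_rw [Finset.mul_sum]
    rw [Finset.sum_congr rfl fun atil _ => Finset.sum_comm, Finset.sum_comm, ← nsmul_eq_mul]
    refine Finset.sum_le_card_nsmul _ _ _ fun j' hj' => ?_
    refine sum_play_indicator_le hn hε π hπ0 hπ1 x₀ ω U t i j' fun t' ht' h => ?_
    exact absurd (hinc t' t i j' j ht'.le h ha) (not_le.mpr (Finset.mem_filter.mp hj').2)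
  have hcard : (J.card : ℝ) ≤ 2 * (M : ℝ) ^ 2 := by
    have h1 : J.card ≤ M := by
      calc J.card ≤ Mi i := by simpa using Finset.card_le_univ J
        _ ≤ M := hM ▸ Finset.single_le_sum (f := Mi) (fun _ _ => Nat.zero_le _)
          (Finset.mem_univ i)
    exact_mod_cast (show J.card ≤ 2 * M ^ 2 by nlinarith [Nat.le_self_pow two_ne_zero M])
  have hpt : ∀ atil : Atil d n Mi, ∑ x : Strat d n,
      play π x₀ atil ω U t x * dot d n (stratVec d n x) (stratVec d n (psi x₀ atil (U t))) ≤
      ∑ x : Strat d n, play π x₀ atil ω U t x * pxval atil ε x (U t) + ε +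
      ∑ x, play π x₀ atil ω U t x *
        ∑ j' ∈ J, (if ε < ip n x.2 (atil i j') then (1 : ℝ) else 0) := by
    intro atil
    have h1 : ∑ x : Strat d n, play π x₀ atil ω U t x * ε = ε := by
      rw [← Finset.sum_mul]
      unfold play
      rw [hπ1, one_mul]
    refine le_of_le_of_eq ?_ (congrArg (fun e => ∑ x : Strat d n,
      play π x₀ atil ω U t x * pxval atil ε x (U t) + e +
      ∑ x, play π x₀ atil ω U t x *
        ∑ j' ∈ J, (if ε < ip n x.2 (atil i j') then (1 : ℝ) else 0)) h1)
    rw [← Finset.sum_add_distrib, ← Finset.sum_add_distrib]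
    refine Finset.sum_le_sum fun x _ => ?_
    rw [← mul_add, ← mul_add, ha]
    exact mul_le_mul_of_nonneg_left (dot_le_pxval_add x₀ atil hε x i j) (hπ0 _ _ _ _)
  have hsum := Finset.sum_le_sum fun (atil : Atil d n Mi) (_ : atil ∈ Finset.univ) => hpt atil
  rw [Finset.sum_add_distrib, Finset.sum_add_distrib, Finset.sum_const, Finset.card_univ,
    nsmul_eq_mul, ← hN] at hsum
  rw [← Finset.mul_sum, ← Finset.mul_sum, inv_mul_le_iff₀ hNpos, mul_add,
    mul_inv_cancel_left₀ hNpos.ne']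
  have := mul_le_mul_of_nonneg_right hcard (mul_nonneg hNpos.le hδ0)
  linarith

lemma sum_average_comm {Ω α β τ : Type*} [Fintype Ω] [Fintype α] [Fintype β] [Fintype τ]
    (w : Ω → ℝ) (D : β → ℝ) (c r : ℝ) (f : Ω → α → β → τ → ℝ) :
    ∑ ω, w ω * ∑ a, c * ∑ U, D U * (r * ∑ t, f ω a U t) =
      ∑ ω, w ω * ∑ U, D U * (r * ∑ t, ∑ a, c * f ω a U t) := by
  refine Finset.sum_congr rfl fun ω _ => ?_
  congr 1
  simp_rw [Finset.mul_sum]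
  rw [Finset.sum_comm]
  refine Finset.sum_congr rfl fun U _ => ?_
  rw [Finset.sum_comm]
  refine Finset.sum_congr rfl fun t _ => Finset.sum_congr rfl fun a _ => ?_
  ring

/-!
STATEMENT 7: In the reduction setup, with `δ = M² e^{-nε²/2}`, the learner's
realized utility satisfies `E[V(Id)] ≤ E[V̄(Id)] + ε + 2δ`, where
`V(Id) = (1/T) ∑_t ∑_{x ∈ X} π^t(x) ⟨x, ũ^t⟩` (with `ũ^t = ψ(u^t)`) and
`V̄(Id) = (1/T) ∑_t ∑_{x ∈ X} π^t(x) p_x(u^t)`.  The expectation is over the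
uniform random `ã`, the sequence `(u^1, …, u^T) ∼ D`, and the learner's seed.
-/
theorem stmt7 (d n T M : ℕ) (hd : 0 < d) (hn : 0 < n) (hT : 0 < T)
    (Mi : Fin d → ℕ) (hM : ∑ i, Mi i = M) (ε : ℝ) (hε : 0 < ε)
    (x₀ : Strat d n)
    (D : (Fin T → Act d Mi) → ℝ)
    (hD0 : ∀ U, 0 ≤ D U) (hD1 : ∑ U, D U = 1)
    (hsupp : ∀ U, 0 < D U → ∀ t, U t ≠ none)
    (hinc : ∀ U, 0 < D U → ∀ (t t' : Fin T) (i : Fin d) (j j' : Fin (Mi i)),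
      t ≤ t' → U t = some ⟨i, j⟩ → U t' = some ⟨i, j'⟩ → j ≤ j')
    (Ω : Type) [Fintype Ω] (w : Ω → ℝ) (hw0 : ∀ ω, 0 ≤ w ω) (hw1 : ∑ ω, w ω = 1)
    (π : Ω → (t : Fin T) → (Fin t.val → Strat d n) → Strat d n → ℝ)
    (hπ0 : ∀ ω t h x, 0 ≤ π ω t h x) (hπ1 : ∀ ω t h, ∑ x, π ω t h x = 1) :
    ∑ ω, w ω * ∑ atil : Atil d n Mi, ((Fintype.card (Atil d n Mi) : ℝ))⁻¹ *
        ∑ U, D U * ((1 / (T : ℝ)) * ∑ t : Fin T, ∑ x : Strat d n,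
          play π x₀ atil ω U t x *
            dot d n (stratVec d n x) (stratVec d n (psi x₀ atil (U t))))
      ≤ (∑ ω, w ω * ∑ atil : Atil d n Mi, ((Fintype.card (Atil d n Mi) : ℝ))⁻¹ *
          ∑ U, D U * ((1 / (T : ℝ)) * ∑ t : Fin T, ∑ x : Strat d n,
            play π x₀ atil ω U t x * pxval atil ε x (U t)))
        + ε + 2 * ((M : ℝ) ^ 2 * Real.exp (-(n : ℝ) * ε ^ 2 / 2)) := by
  rw [sum_average_comm, sum_average_comm, add_assoc]
  set K := ε + 2 * ((M : ℝ) ^ 2 * Real.exp (-(n : ℝ) * ε ^ 2 / 2)) with hK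
  have hT' : (0 : ℝ) < T := Nat.cast_pos.mpr hT
  have hconst : ∑ ω, w ω * ∑ U, D U * ((1 / (T : ℝ)) * ∑ _t : Fin T, K) = K := by
    have h1 : (1 / (T : ℝ)) * ∑ _t : Fin T, K = K := by
      simp [hT'.ne']
    rw [h1, ← Finset.sum_mul, hw1, ← Finset.sum_mul, hD1, one_mul, one_mul]
  conv_rhs => rw [← hconst]
  rw [← Finset.sum_add_distrib]
  refine Finset.sum_le_sum fun ω _ => ?_
  rw [← mul_add, ← Finset.sum_add_distrib]
  refine mul_le_mul_of_nonneg_left (Finset.sum_le_sum fun U _ => ?_) (hw0 ω)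
  rcases (hD0 U).eq_or_lt with h0 | hpos
  · simp [← h0]
  rw [← mul_add, ← mul_add, ← Finset.sum_add_distrib]
  refine mul_le_mul_of_nonneg_left (mul_le_mul_of_nonneg_left
    (Finset.sum_le_sum fun t _ => ?_) (by positivity)) hpos.le
  exact average_utility_le hn hM hε x₀ U (hsupp U hpos) (hinc U hpos) π hπ0 hπ1 ω t
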